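/- arXiv:0908.3686 — 3 statements merged into one kernel-verified Lean document; each statement's English description precedes it below -/
import Mathlib

section
/- (Exponential off-diagonal decay above the critical temperature for the ideal gas.) For every T > 0 and μ < 0 there exists a constant C > 0 such that k_μ(r) ≤ C e^{−√(−μ) r} for all r ≥ 0, where k_μ(r) = Σ_{n≥1} e^{μ n/T} (T/(4πn))^{3/2} e^{−T r²/(4n)}. -/
open MeasureTheory Filter Real

noncomputable section

/-- The off-diagonal kernel `k_μ(r) = Σ_{n≥1} e^{μn/T} (T/(4πn))^{3/2} e^{−Tr²/(4n)}`
of the one-particle density matrix of the ideal Bose gas in the thermodynamic limit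
(up to the condensate contribution). -/
noncomputable def idealKernel (T μ r : ℝ) : ℝ :=
  ∑' n : ℕ, Real.exp (μ * (n + 1) / T) * (T / (4 * π * (n + 1))) ^ ((3:ℝ) / 2) *
    Real.exp (-(T * r ^ 2) / (4 * (n + 1)))

/-- Exponential off-diagonal decay above the critical temperature for the ideal
Bose gas: for `T > 0` and `μ < 0` there is `C > 0` with
`k_μ(r) ≤ C e^{−√(−μ) r}` for all `r ≥ 0`. -/
theorem idealKernel_exponential_decay (T μ : ℝ) (hT : 0 < T) (hμ : μ < 0) :
    ∃ C > (0:ℝ), ∀ r : ℝ, 0 ≤ r →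
      idealKernel T μ r ≤ C * Real.exp (-Real.sqrt (-μ) * r) := by
  have hs : Summable (fun n : ℕ => (T / (4 * π * ((n:ℝ) + 1))) ^ ((3:ℝ) / 2)) := by
    have h1 : Summable (fun n : ℕ => (1:ℝ) / ((n:ℝ)) ^ ((3:ℝ) / 2)) :=
      Real.summable_one_div_nat_rpow.2 (by norm_num)
    have h2 := ((summable_nat_add_iff 1).2 h1).mul_left ((T / (4 * π)) ^ ((3:ℝ) / 2))
    refine h2.congr fun n => ?_
    have hn : (0:ℝ) < (n:ℝ) + 1 := by positivity
    have hp : 0 ≤ T / (4 * π) := by positivity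
    push_cast
    rw [← div_div T (4 * π), Real.div_rpow hp hn.le]
    ring
  have hnn : ∀ n : ℕ, 0 ≤ (T / (4 * π * ((n:ℝ) + 1))) ^ ((3:ℝ) / 2) := fun n => by positivity
  refine ⟨(∑' n : ℕ, (T / (4 * π * ((n:ℝ) + 1))) ^ ((3:ℝ) / 2)) + 1, ?_, ?_⟩
  · have := tsum_nonneg (L := SummationFilter.unconditional ℕ) hnn
    linarith
  intro r hr
  have hle : ∀ n : ℕ, Real.exp (μ * (n + 1) / T) * (T / (4 * π * (n + 1))) ^ ((3:ℝ) / 2) *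
      Real.exp (-(T * r ^ 2) / (4 * (n + 1))) ≤
      (T / (4 * π * ((n:ℝ) + 1))) ^ ((3:ℝ) / 2) * Real.exp (-Real.sqrt (-μ) * r) := by
    intro n
    have hn : (0:ℝ) < (n:ℝ) + 1 := by positivity
    have hq : Real.sqrt (-μ) ^ 2 = -μ := Real.sq_sqrt (by linarith)
    have key : μ * (n + 1) / T + -(T * r ^ 2) / (4 * (n + 1)) ≤ -Real.sqrt (-μ) * r := by
      set q := Real.sqrt (-μ)
      have hm : μ = -q ^ 2 := by linarith
      have e : -q * r - (μ * (n + 1) / T + -(T * r ^ 2) / (4 * (n + 1))) =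
          (2 * q * ((n:ℝ) + 1) - T * r) ^ 2 / (4 * T * ((n:ℝ) + 1)) := by
        rw [hm]
        field_simp
        ring
      have : 0 ≤ (2 * q * ((n:ℝ) + 1) - T * r) ^ 2 / (4 * T * ((n:ℝ) + 1)) := by positivity
      linarith
    rw [mul_right_comm, ← Real.exp_add, mul_comm]
    exact mul_le_mul_of_nonneg_left (Real.exp_le_exp.2 key) (hnn n)
  have hs2 := hs.mul_right (Real.exp (-Real.sqrt (-μ) * r))
  have h3 := Summable.tsum_le_tsum hle
    (Summable.of_nonneg_of_le (fun n => by positivity) hle hs2) hs2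
  rw [tsum_mul_right] at h3
  unfold idealKernel
  refine h3.trans ?_
  gcongr
  linarith
end
end

section
/- (Algebraic decay at the critical point for the ideal gas.) For every T > 0, the critical kernel k₀(r) = Σ_{n≥1} (T/(4πn))^{3/2} e^{−T r²/(4n)} satisfies lim_{r→∞} r · k₀(r) = T/(4π); in particular γ(x,y) ~ |x−y|^{−1} at T = T_c. -/
open MeasureTheory Filter Real

noncomputable section

/-- Rescaled summand. -/
def hKer (T m : ℝ) : ℝ := (T / (4 * π * m)) ^ ((3:ℝ) / 2) * Real.exp (-T / (4 * m))

/-- Dominating function. -/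
def domKer (T s : ℝ) : ℝ :=
  (Set.Ioc (0:ℝ) 1).indicator (fun _ => (2:ℝ)) s +
    (Set.Ioi (1:ℝ)).indicator (fun s => (T / (4 * π)) ^ ((3:ℝ) / 2) * s ^ (-(3:ℝ) / 2)) s

lemma domKer_integrable (T : ℝ) : Integrable (domKer T) := by
  unfold domKer
  apply Integrable.add
  · rw [integrable_indicator_iff measurableSet_Ioc]
    exact integrableOn_const (by simp)
  · rw [integrable_indicator_iff measurableSet_Ioi]
    exact (integrableOn_Ioi_rpow_of_lt (by norm_num) one_pos).const_mul _

lemma hKer_nonneg (T m : ℝ) (hT : 0 < T) (hm : 0 < m) : 0 ≤ hKer T m := by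
  unfold hKer; positivity

lemma hKer_le_two (T m : ℝ) (hT : 0 < T) (hm : 0 < m) : hKer T m ≤ 2 := by
  unfold hKer
  have hx : 0 < T / (4 * m) := by positivity
  have e1 : -T / (4 * m) = -(T / (4 * m)) := by ring
  have e2 : T / (4 * π * m) ≤ T / (4 * m) := by
    apply div_le_div_of_nonneg_left hT.le (by positivity)
    nlinarith [Real.pi_gt_three]
  rw [e1, Real.exp_neg, ← div_eq_mul_inv, div_le_iff₀ (Real.exp_pos _)]
  have h0 : (T / (4 * π * m)) ^ ((3:ℝ) / 2) ≤ (T / (4 * m)) ^ ((3:ℝ) / 2) :=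
    Real.rpow_le_rpow (by positivity) e2 (by norm_num)
  generalize T / (4 * m) = x at *
  have h1 : x ^ ((3:ℝ)/2) ≤ 1 + x ^ 2 := by
    rcases le_total x 1 with h | h
    · have := Real.rpow_le_one hx.le h (by norm_num : (0:ℝ) ≤ 3/2)
      nlinarith [sq_nonneg x]
    · have := Real.rpow_le_rpow_of_exponent_le h (by norm_num : (3:ℝ)/2 ≤ 2)
      rw [Real.rpow_two] at this
      linarith
  have := Real.quadratic_le_exp_of_nonneg hx.le
  linarith

lemma hKer_le_dom (T s m : ℝ) (hT : 0 < T) (hs : 0 < s) (hm : s ≤ m) : hKer T m ≤ domKer T s := by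
  have hm0 : 0 < m := by linarith
  unfold domKer
  rcases le_or_gt s 1 with h | h
  · rw [Set.indicator_of_mem (by exact ⟨hs, h⟩), Set.indicator_of_notMem (by simpa using h)]
    simpa using hKer_le_two T m hT hm0
  · rw [Set.indicator_of_notMem (by simp [h]), Set.indicator_of_mem (by exact h), zero_add]
    have e : (T / (4 * π)) ^ ((3:ℝ) / 2) * s ^ (-(3:ℝ) / 2) = (T / (4 * π * s)) ^ ((3:ℝ) / 2) := by
      rw [← div_div T (4 * π) s, Real.div_rpow (by positivity) hs.le, neg_div, Real.rpow_neg hs.le, ← div_eq_mul_inv]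
    rw [e]
    unfold hKer
    have h1 : Real.exp (-T / (4 * m)) ≤ 1 := by
      rw [Real.exp_le_one_iff]
      apply div_nonpos_of_nonpos_of_nonneg <;> [linarith; positivity]
    have h2 : (T / (4 * π * m)) ^ ((3:ℝ) / 2) ≤ (T / (4 * π * s)) ^ ((3:ℝ) / 2) := by
      apply Real.rpow_le_rpow (by positivity) _ (by norm_num)
      gcongr
    have h3 : 0 ≤ (T / (4 * π * m)) ^ ((3:ℝ) / 2) := by positivity
    nlinarith

lemma hKer_integral (T : ℝ) (hT : 0 < T) : ∫ s in Set.Ioi (0:ℝ), hKer T s = T / (4 * π) := by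
  have h := integral_comp_rpow_Ioi (fun y : ℝ => 2 * (T / (4 * π)) ^ ((3:ℝ) / 2) * Real.exp (-(T/4) * y ^ 2))
    (p := -(1/2)) (by norm_num)
  rw [integral_const_mul, integral_gaussian_Ioi] at h
  have e : ∫ s in Set.Ioi (0:ℝ), hKer T s =
      2 * (T / (4 * π)) ^ ((3:ℝ) / 2) * (√(π / (T/4)) / 2) := by
    rw [← h]
    apply setIntegral_congr_fun measurableSet_Ioi
    intro s hs
    have hs : 0 < s := hs
    have e1 : (s ^ (-(1/2) : ℝ)) ^ 2 = s⁻¹ := by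
      rw [← Real.rpow_natCast, ← Real.rpow_mul hs.le]
      norm_num [Real.rpow_neg_one]
    have e2 : (T / (4 * π * s)) ^ ((3:ℝ) / 2) = (T / (4 * π)) ^ ((3:ℝ) / 2) * s ^ (-(3:ℝ) / 2) := by
      rw [← div_div, Real.div_rpow (by positivity) hs.le, neg_div, Real.rpow_neg hs.le, div_eq_mul_inv]
    simp only [hKer, smul_eq_mul, e1, e2]
    have e3 : -T / (4 * s) = -(T/4) * s⁻¹ := by field_simp
    have e4 : (-(1/2) - 1 : ℝ) = -3/2 := by norm_num
    rw [e3, e4, abs_of_neg (by norm_num)]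
    ring
  rw [e]
  have e5 : π / (T/4) = (T / (4 * π))⁻¹ := by field_simp
  rw [e5, Real.sqrt_inv, Real.sqrt_eq_rpow]
  have hc : 0 < T / (4 * π) := by positivity
  generalize T / (4 * π) = c at *
  have : c ^ ((3:ℝ)/2) = c * c ^ ((1:ℝ)/2) := by
    rw [← Real.rpow_one_add' hc.le (by norm_num)]; norm_num
  rw [this]
  have : 0 < c ^ ((1:ℝ)/2) := by positivity
  field_simp

/-- Step approximation. -/
def stepKer (T R s : ℝ) : ℝ := hKer T (((⌊R * s⌋₊ : ℝ) + 1) / R)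

lemma stepKer_measurable (T R : ℝ) : Measurable (stepKer T R) := by
  unfold stepKer
  exact (measurable_from_nat (f := fun n : ℕ => hKer T (((n : ℝ) + 1) / R))).comp
    (Nat.measurable_floor.comp (measurable_const_mul R))

lemma stepKer_arg (R s : ℝ) (hR : 0 < R) : s ≤ ((⌊R * s⌋₊ : ℝ) + 1) / R := by
  rw [le_div_iff₀ hR]
  have := Nat.lt_floor_add_one (R * s)
  linarith

lemma stepKer_bound (T R s : ℝ) (hT : 0 < T) (hR : 0 < R) (hs : 0 < s) :
    ‖stepKer T R s‖ ≤ domKer T s := by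
  have h := stepKer_arg R s hR
  unfold stepKer
  rw [Real.norm_of_nonneg (hKer_nonneg T _ hT (by linarith))]
  exact hKer_le_dom T s _ hT hs h

lemma stepKer_integrable (T R : ℝ) (hT : 0 < T) (hR : 0 < R) :
    IntegrableOn (stepKer T R) (Set.Ioi 0) := by
  apply Integrable.mono' (domKer_integrable T).integrableOn
    (stepKer_measurable T R).aestronglyMeasurable
  filter_upwards [ae_restrict_mem measurableSet_Ioi] with s hs
  exact stepKer_bound T R s hT hR hs

lemma stepKer_integral (T R : ℝ) (hT : 0 < T) (hR : 0 < R) :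
    ∫ s in Set.Ioi (0:ℝ), stepKer T R s = ∑' n : ℕ, R⁻¹ * hKer T (((n:ℝ) + 1) / R) := by
  have hU : (⋃ n : ℕ, Set.Ico ((n:ℝ) / R) (((n:ℝ) + 1) / R)) = Set.Ici (0:ℝ) := by
    ext s
    simp only [Set.mem_iUnion, Set.mem_Ico, Set.mem_Ici]
    constructor
    · rintro ⟨n, h, -⟩
      exact le_trans (by positivity) h
    · intro hs
      refine ⟨⌊R * s⌋₊, ?_, ?_⟩
      · rw [div_le_iff₀ hR, mul_comm s]
        exact Nat.floor_le (by positivity)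
      · rw [lt_div_iff₀ hR, mul_comm s]
        exact Nat.lt_floor_add_one _
  have hfl : ∀ (n : ℕ) (s : ℝ), s ∈ Set.Ico ((n:ℝ) / R) (((n:ℝ) + 1) / R) → ⌊R * s⌋₊ = n := by
    rintro n s ⟨h1, h2⟩
    rw [div_le_iff₀ hR, mul_comm s] at h1
    rw [lt_div_iff₀ hR, mul_comm s] at h2
    rw [Nat.floor_eq_iff (le_trans (by positivity) h1)]
    exact ⟨h1, h2⟩
  rw [← integral_Ici_eq_integral_Ioi, ← hU]
  have hs := hasSum_integral_iUnion (μ := volume) (f := stepKer T R)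
    (s := fun n : ℕ => Set.Ico ((n:ℝ) / R) (((n:ℝ) + 1) / R))
    (fun _ => measurableSet_Ico) (by
      intro i j hij
      refine Set.disjoint_left.mpr fun s hi hj => hij ?_
      rw [← hfl i s hi, ← hfl j s hj])
    (by rw [hU, integrableOn_Ici_iff_integrableOn_Ioi]; exact stepKer_integrable T R hT hR)
  rw [← hs.tsum_eq]
  congr 1
  ext n
  rw [setIntegral_congr_fun (g := fun _ => hKer T (((n:ℝ) + 1) / R)) measurableSet_Ico]
  · have : ((n:ℝ) + 1) / R - n / R = R⁻¹ := by field_simp; ring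
    simp [this, hR.le]
  · intro s hs
    simp only [stepKer, hfl n s hs]

lemma kernel_eq (T r : ℝ) (hT : 0 < T) (hr : 0 < r) :
    r * idealKernel T 0 r = ∫ s in Set.Ioi (0:ℝ), stepKer T (r ^ 2) s := by
  rw [stepKer_integral T _ hT (by positivity), idealKernel, ← tsum_mul_left]
  congr 1
  ext n
  have e1 : T / (4 * π * (((n:ℝ) + 1) / r ^ 2)) = T / (4 * π * (n + 1)) * r ^ 2 := by
    field_simp
  have e2 : -T / (4 * (((n:ℝ) + 1) / r ^ 2)) = -(T * r ^ 2) / (4 * (n + 1)) := by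
    field_simp
  have e3 : (r ^ 2) ^ ((3:ℝ) / 2) = r ^ 3 := by
    rw [← Real.rpow_natCast, ← Real.rpow_natCast, ← Real.rpow_mul hr.le]; norm_num
  rw [hKer, e1, e2, Real.mul_rpow (by positivity) (by positivity), e3]
  simp only [zero_mul, zero_div, Real.exp_zero, one_mul]
  field_simp

/-- Algebraic decay at the critical point for the ideal Bose gas: for every `T > 0`
the critical kernel satisfies `lim_{r→∞} r · k₀(r) = T/(4π)`; in particular
`γ(x,y) ~ |x−y|⁻¹` at `T = T_c`. -/
theorem idealKernel_critical_decay (T : ℝ) (hT : 0 < T) :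
    Tendsto (fun r : ℝ => r * idealKernel T 0 r) atTop (nhds (T / (4 * π))) := by
  rw [← hKer_integral T hT]
  have key : Tendsto (fun r : ℝ => ∫ s in Set.Ioi (0:ℝ), stepKer T (r ^ 2) s) atTop
      (nhds (∫ s in Set.Ioi (0:ℝ), hKer T s)) := by
    apply tendsto_integral_filter_of_dominated_convergence (domKer T)
    · exact Eventually.of_forall fun r => (stepKer_measurable T _).aestronglyMeasurable
    · filter_upwards [eventually_gt_atTop 0] with r hr
      filter_upwards [ae_restrict_mem measurableSet_Ioi] with s hs
      exact stepKer_bound T _ s hT (by positivity) hs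
    · exact (domKer_integrable T).integrableOn
    · filter_upwards [ae_restrict_mem measurableSet_Ioi] with s hs
      have hs : 0 < s := hs
      have hc : ContinuousAt (hKer T) s := by
        unfold hKer
        apply ContinuousAt.mul
        · apply ContinuousAt.rpow_const
          · exact continuousAt_const.div (by fun_prop) (by positivity)
          · right; norm_num
        · exact (continuousAt_const.div (by fun_prop) (by positivity)).rexp
      apply hc.tendsto.comp
      have hlim : Tendsto (fun r : ℝ => s + 1 / r ^ 2) atTop (nhds s) := by
        have : Tendsto (fun r : ℝ => 1 / r ^ 2) atTop (nhds 0) := by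
          simp only [one_div]
          exact (tendsto_pow_atTop (α := ℝ) (n := 2) (by norm_num)).inv_tendsto_atTop
        simpa using this.const_add s
      refine tendsto_of_tendsto_of_tendsto_of_le_of_le' tendsto_const_nhds hlim ?_ ?_
      · filter_upwards [eventually_gt_atTop 0] with r hr
        exact stepKer_arg (r ^ 2) s (by positivity)
      · filter_upwards [eventually_gt_atTop 0] with r hr
        have hR : 0 < r ^ 2 := by positivity
        have := Nat.floor_le (show 0 ≤ r ^ 2 * s by positivity)
        rw [div_le_iff₀ hR, add_mul, one_div, inv_mul_cancel₀ hR.ne']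
        linarith
  refine key.congr' ?_
  filter_upwards [eventually_gt_atTop 0] with r hr
  exact (kernel_eq T r hT hr).symm
end
end

section
/- (Yrast curve for small angular momentum.) For all N ≥ 2 and all integers 0 ≤ L ≤ N, the yrast value Δ_N(L) is given explicitly by: Δ_N(L) = (2π)^{−3/2} · N(N−1)/2 for L ∈ {0,1}, and Δ_N(L) = (2π)^{−3/2} · (N/2)(N − 1 − L/2) for 2 ≤ L ≤ N. -/
open MeasureTheory Filter Real

noncomputable section

/-- The projected contact interaction `δ_{ij}` on the Bargmann space:
`(δ_{ij} f)(z₁,…,z_N) = (2π)^{−3/2} f(…, (z_i+z_j)/2, …, (z_i+z_j)/2, …)`,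
with both the `i`-th and `j`-th arguments replaced by `(z_i+z_j)/2`. -/
noncomputable def deltaPair (N : ℕ) (i j : Fin N) (F : (Fin N → ℂ) → ℂ)
    (z : Fin N → ℂ) : ℂ :=
  (((2 * π) ^ (-(3:ℝ) / 2) : ℝ) : ℂ) *
    F (Function.update (Function.update z i ((z i + z j) / 2)) j ((z i + z j) / 2))

/-- The total contact interaction `Δ_N = Σ_{i<j} δ_{ij}`. -/
noncomputable def DeltaN (N : ℕ) (F : (Fin N → ℂ) → ℂ) (z : Fin N → ℂ) : ℂ :=
  ∑ p ∈ Finset.univ.filter (fun p : Fin N × Fin N => p.1 < p.2),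
    deltaPair N p.1 p.2 F z

/-- The Bargmann-space inner product
`⟨F, G⟩ = ∫_{ℂᴺ} conj(F z) G z Π_i e^{−|z_i|²/2} dz`. -/
noncomputable def bargmannInner (N : ℕ) (F G : (Fin N → ℂ) → ℂ) : ℂ :=
  ∫ z : Fin N → ℂ,
    (starRingEnd ℂ) (F z) * G z * ((∏ i : Fin N, Real.exp (-‖z i‖ ^ 2 / 2) : ℝ) : ℂ)

/-- The yrast value `Δ_N(L)`: the infimum of the Rayleigh quotient
`⟨f, Δ_N f⟩/⟨f, f⟩` over nonzero symmetric polynomials `f` on `ℂᴺ`,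
homogeneous of degree `L`. -/
noncomputable def yrast (N : ℕ) (L : ℕ) : ℝ :=
  sInf {r : ℝ | ∃ f : MvPolynomial (Fin N) ℂ, f ≠ 0 ∧ f.IsSymmetric ∧
    f.IsHomogeneous L ∧
    (r : ℂ) = bargmannInner N (fun z => MvPolynomial.eval z f)
        (DeltaN N (fun z => MvPolynomial.eval z f)) /
      bargmannInner N (fun z => MvPolynomial.eval z f) (fun z => MvPolynomial.eval z f)}


/-- One-variable norm of `z^n`. -/
noncomputable def ybW (n : ℕ) : ℝ := 2 * π * 2 ^ n * (n.factorial : ℝ)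

lemma ybW_pos (n : ℕ) : 0 < ybW n := by
  unfold ybW; positivity

lemma ybW_succ (n : ℕ) : ybW (n + 1) = 2 * (n + 1) * ybW n := by
  unfold ybW; rw [Nat.factorial_succ]; push_cast; ring

lemma yb_norm_integral (k : ℕ) :
    ∫ z : ℂ, ‖z‖ ^ (k : ℝ) * Real.exp (-(1/2) * ‖z‖ ^ (2 : ℝ)) =
      (2 * π / 2) * (1/2 : ℝ) ^ (-((k : ℝ) + 2) / 2) * Real.Gamma (((k : ℝ) + 2) / 2) :=
  Complex.integral_rpow_mul_exp_neg_mul_rpow (by norm_num)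
    (by have : (0 : ℝ) ≤ k := Nat.cast_nonneg k
        linarith) (by norm_num)

lemma yb_norm_integrable (k : ℕ) :
    Integrable (fun z : ℂ => ‖z‖ ^ k * Real.exp (-‖z‖ ^ 2 / 2)) := by
  have h : Integrable (fun z : ℂ => ‖z‖ ^ (k : ℝ) * Real.exp (-(1/2) * ‖z‖ ^ (2 : ℝ))) := by
    apply Integrable.of_integral_ne_zero
    rw [yb_norm_integral]
    have : 0 < Real.Gamma (((k : ℝ) + 2) / 2) := Real.Gamma_pos_of_pos (by positivity)
    positivity
  refine h.congr (Filter.Eventually.of_forall fun z => ?_)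
  simp only [Real.rpow_natCast, Real.rpow_two]
  congr 2; ring

lemma yb_one_integrable (m n : ℕ) :
    Integrable (fun z : ℂ => (starRingEnd ℂ) z ^ m * z ^ n * ((Real.exp (-‖z‖ ^ 2 / 2) : ℝ) : ℂ)) := by
  refine (yb_norm_integrable (m + n)).mono' ?_ (Filter.Eventually.of_forall fun z => ?_)
  · apply Continuous.aestronglyMeasurable
    fun_prop
  · rw [norm_mul, norm_mul, norm_pow, norm_pow, RCLike.norm_conj, Complex.norm_real,
      Real.norm_of_nonneg (Real.exp_nonneg _), pow_add]

lemma yb_one_diag (n : ℕ) :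
    ∫ z : ℂ, (starRingEnd ℂ) z ^ n * z ^ n * ((Real.exp (-‖z‖ ^ 2 / 2) : ℝ) : ℂ) = (ybW n : ℂ) := by
  have h := yb_norm_integral (2 * n)
  have e1 : ∀ z : ℂ, (starRingEnd ℂ) z ^ n * z ^ n * ((Real.exp (-‖z‖ ^ 2 / 2) : ℝ) : ℂ) =
      ((‖z‖ ^ ((2 * n : ℕ) : ℝ) * Real.exp (-(1/2) * ‖z‖ ^ (2 : ℝ)) : ℝ) : ℂ) := by
    intro z
    rw [Real.rpow_natCast, Real.rpow_two, ← mul_pow, mul_comm ((starRingEnd ℂ) z), Complex.mul_conj,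
      Complex.normSq_eq_norm_sq, pow_mul]
    push_cast
    congr 2; ring
  simp_rw [e1]
  rw [integral_complex_ofReal, h]
  congr 1
  have e2 : (((2 * n : ℕ) : ℝ) + 2) / 2 = (n : ℝ) + 1 := by push_cast; ring
  have e3 : -(((2 * n : ℕ) : ℝ) + 2) / 2 = -((n + 1 : ℕ) : ℝ) := by push_cast; ring
  rw [e3, e2, Real.Gamma_nat_eq_factorial, Real.rpow_neg (by norm_num), Real.rpow_natCast]
  unfold ybW
  rw [one_div, inv_pow, inv_inv]; ring

lemma yb_one_off (m n : ℕ) (hmn : m ≠ n) :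
    ∫ z : ℂ, (starRingEnd ℂ) z ^ m * z ^ n * ((Real.exp (-‖z‖ ^ 2 / 2) : ℝ) : ℂ) = 0 := by
  -- rotate by `exp(I)`
  set F : ℂ → ℂ := fun z => (starRingEnd ℂ) z ^ m * z ^ n * ((Real.exp (-‖z‖ ^ 2 / 2) : ℝ) : ℂ)
  let c : Circle := Circle.exp 1
  have hc : (c : ℂ) = Complex.exp Complex.I := by simp [c, Circle.coe_exp]
  have h1 : ∫ z : ℂ, F (rotation c z) = ∫ z : ℂ, F z :=
    (rotation c).measurePreserving.integral_comp
      (rotation c).toHomeomorph.measurableEmbedding F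
  have h2 : ∀ z, F (rotation c z) = ((starRingEnd ℂ) (c : ℂ) ^ m * (c : ℂ) ^ n) * F z := by
    intro z
    simp only [F, rotation_apply, map_mul, norm_mul, Circle.norm_coe, one_mul, mul_pow]
    ring
  simp_rw [h2] at h1
  rw [integral_const_mul] at h1
  by_contra hne
  have h3 : ((starRingEnd ℂ) (c : ℂ) ^ m * (c : ℂ) ^ n) = 1 :=
    mul_right_cancel₀ hne (by rw [h1, one_mul])
  rw [hc, ← Complex.exp_conj, Complex.conj_I, ← Complex.exp_nat_mul, ← Complex.exp_nat_mul,
    ← Complex.exp_add, Complex.exp_eq_one_iff] at h3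
  obtain ⟨k, hk⟩ := h3
  have h4 : ((n : ℂ) - m) = k * (2 * π) := by
    have := mul_right_cancel₀ Complex.I_ne_zero
      (show ((n : ℂ) - m) * Complex.I = (k * (2 * π)) * Complex.I by linear_combination hk)
    exact this
  have h5 : ((n : ℝ) - m) = k * (2 * π) := by exact_mod_cast h4
  have hk0 : (k : ℝ) ≠ 0 := by
    intro h0
    rw [h0, zero_mul, sub_eq_zero] at h5
    exact hmn (by exact_mod_cast h5.symm)
  apply irrational_pi
  refine ⟨((n : ℚ) - m) / (2 * k), ?_⟩
  push_cast
  rw [h5]; field_simp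

noncomputable def ybWt {N : ℕ} (α : Fin N →₀ ℕ) : ℝ := ∏ k, ybW (α k)

lemma ybWt_pos {N : ℕ} (α : Fin N →₀ ℕ) : 0 < ybWt α :=
  Finset.prod_pos fun _ _ => ybW_pos _

lemma yb_mono_rw {N : ℕ} (α β : Fin N →₀ ℕ) (z : Fin N → ℂ) :
    (starRingEnd ℂ) (∏ k, z k ^ α k) * (∏ k, z k ^ β k) *
      ((∏ i : Fin N, Real.exp (-‖z i‖ ^ 2 / 2) : ℝ) : ℂ) =
    ∏ k, ((starRingEnd ℂ) (z k) ^ α k * z k ^ β k * ((Real.exp (-‖z k‖ ^ 2 / 2) : ℝ) : ℂ)) := by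
  rw [map_prod, Complex.ofReal_prod, ← Finset.prod_mul_distrib, ← Finset.prod_mul_distrib]
  simp

lemma yb_mono_integrable {N : ℕ} (α β : Fin N →₀ ℕ) :
    Integrable (fun z : Fin N → ℂ => (starRingEnd ℂ) (∏ k, z k ^ α k) * (∏ k, z k ^ β k) *
      ((∏ i : Fin N, Real.exp (-‖z i‖ ^ 2 / 2) : ℝ) : ℂ)) := by
  simp_rw [yb_mono_rw]
  exact Integrable.fintype_prod (fun k => yb_one_integrable (α k) (β k))

lemma yb_mono_integral {N : ℕ} (α β : Fin N →₀ ℕ) :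
    ∫ z : Fin N → ℂ, (starRingEnd ℂ) (∏ k, z k ^ α k) * (∏ k, z k ^ β k) *
      ((∏ i : Fin N, Real.exp (-‖z i‖ ^ 2 / 2) : ℝ) : ℂ) = if α = β then (ybWt α : ℂ) else 0 := by
  simp_rw [yb_mono_rw]
  rw [integral_fintype_prod_volume_eq_prod
    (f := fun k (w : ℂ) => (starRingEnd ℂ) w ^ α k * w ^ β k * ((Real.exp (-‖w‖ ^ 2 / 2) : ℝ) : ℂ))]
  split_ifs with h
  · subst h
    simp_rw [yb_one_diag]
    simp [ybWt]
  · have : ∃ k, α k ≠ β k := by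
      by_contra hcon
      push Not at hcon
      exact h (Finsupp.ext hcon)
    obtain ⟨k, hk⟩ := this
    exact Finset.prod_eq_zero (Finset.mem_univ k) (yb_one_off _ _ hk)

/-- The inner product on polynomials. -/
noncomputable def ybI {N : ℕ} (f g : MvPolynomial (Fin N) ℂ) : ℂ :=
  bargmannInner N (fun z => MvPolynomial.eval z f) (fun z => MvPolynomial.eval z g)

lemma ybI_eq {N : ℕ} (f g : MvPolynomial (Fin N) ℂ) :
    ybI f g = ∑ α ∈ f.support, (starRingEnd ℂ) (f.coeff α) * g.coeff α * (ybWt α : ℂ) := by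
  unfold ybI bargmannInner
  have h : ∀ z : Fin N → ℂ, (starRingEnd ℂ) (MvPolynomial.eval z f) * MvPolynomial.eval z g *
      ((∏ i : Fin N, Real.exp (-‖z i‖ ^ 2 / 2) : ℝ) : ℂ) =
      ∑ α ∈ f.support, ∑ β ∈ g.support, ((starRingEnd ℂ) (f.coeff α) * g.coeff β) *
        ((starRingEnd ℂ) (∏ k, z k ^ α k) * (∏ k, z k ^ β k) *
      ((∏ i : Fin N, Real.exp (-‖z i‖ ^ 2 / 2) : ℝ) : ℂ)) := by
    intro z
    rw [MvPolynomial.eval_eq', MvPolynomial.eval_eq', map_sum, Finset.sum_mul_sum, Finset.sum_mul]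
    refine Finset.sum_congr rfl fun α _ => ?_
    rw [Finset.sum_mul]
    refine Finset.sum_congr rfl fun β _ => ?_
    rw [map_mul]; ring
  simp_rw [h]
  rw [integral_finsetSum _ (fun α _ => integrable_finsetSum _ (fun β _ =>
    (yb_mono_integrable α β).const_mul _))]
  refine Finset.sum_congr rfl fun α _ => ?_
  rw [integral_finsetSum _ (fun β _ => (yb_mono_integrable α β).const_mul _)]
  simp_rw [integral_const_mul, yb_mono_integral]
  by_cases hβ : α ∈ g.support
  · simp [hβ]
  · rw [MvPolynomial.notMem_support_iff.mp hβ]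
    simp only [mul_zero, zero_mul]
    refine Finset.sum_eq_zero fun β hb => ?_
    rw [if_neg (by rintro rfl; exact hβ hb), mul_zero]

lemma ybI_eq_of_subset {N : ℕ} (f g : MvPolynomial (Fin N) ℂ) (S : Finset (Fin N →₀ ℕ))
    (hS : f.support ⊆ S) :
    ybI f g = ∑ α ∈ S, (starRingEnd ℂ) (f.coeff α) * g.coeff α * (ybWt α : ℂ) := by
  rw [ybI_eq]
  refine Finset.sum_subset hS fun α _ hα => ?_
  rw [MvPolynomial.notMem_support_iff.mp hα]; simp

lemma ybI_add_left {N : ℕ} (f₁ f₂ g : MvPolynomial (Fin N) ℂ) :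
    ybI (f₁ + f₂) g = ybI f₁ g + ybI f₂ g := by
  classical
  rw [ybI_eq_of_subset (f₁ + f₂) g (f₁.support ∪ f₂.support) MvPolynomial.support_add,
    ybI_eq_of_subset f₁ g _ Finset.subset_union_left,
    ybI_eq_of_subset f₂ g _ Finset.subset_union_right, ← Finset.sum_add_distrib]
  refine Finset.sum_congr rfl fun α _ => ?_
  rw [MvPolynomial.coeff_add, map_add]; ring

lemma ybI_add_right {N : ℕ} (f g₁ g₂ : MvPolynomial (Fin N) ℂ) :
    ybI f (g₁ + g₂) = ybI f g₁ + ybI f g₂ := by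
  simp_rw [ybI_eq, ← Finset.sum_add_distrib]
  refine Finset.sum_congr rfl fun α _ => ?_
  rw [MvPolynomial.coeff_add]; ring

lemma ybI_C_mul_right {N : ℕ} (f g : MvPolynomial (Fin N) ℂ) (c : ℂ) :
    ybI f (MvPolynomial.C c * g) = c * ybI f g := by
  simp_rw [ybI_eq, Finset.mul_sum]
  refine Finset.sum_congr rfl fun α _ => ?_
  rw [MvPolynomial.coeff_C_mul]; ring

lemma ybI_zero_right {N : ℕ} (f : MvPolynomial (Fin N) ℂ) : ybI f 0 = 0 := by
  simp [ybI_eq]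

lemma ybI_sub_right {N : ℕ} (f g₁ g₂ : MvPolynomial (Fin N) ℂ) :
    ybI f (g₁ - g₂) = ybI f g₁ - ybI f g₂ := by
  simp_rw [ybI_eq, ← Finset.sum_sub_distrib]
  refine Finset.sum_congr rfl fun α _ => ?_
  rw [MvPolynomial.coeff_sub]; ring

lemma ybI_sum_right {N : ℕ} {ι : Type*} (f : MvPolynomial (Fin N) ℂ) (s : Finset ι)
    (g : ι → MvPolynomial (Fin N) ℂ) :
    ybI f (∑ x ∈ s, g x) = ∑ x ∈ s, ybI f (g x) := by
  classical
  induction s using Finset.induction_on with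
  | empty => simp [ybI_zero_right]
  | insert a s ha ih => rw [Finset.sum_insert ha, Finset.sum_insert ha, ybI_add_right, ih]

lemma ybI_sum_left {N : ℕ} {ι : Type*} (g : MvPolynomial (Fin N) ℂ) (s : Finset ι)
    (f : ι → MvPolynomial (Fin N) ℂ) :
    ybI (∑ x ∈ s, f x) g = ∑ x ∈ s, ybI (f x) g := by
  classical
  induction s using Finset.induction_on with
  | empty => simp [ybI_eq]
  | insert a s ha ih => rw [Finset.sum_insert ha, Finset.sum_insert ha, ybI_add_left, ih]

/-- real-valued squared norm -/
noncomputable def ybN {N : ℕ} (f : MvPolynomial (Fin N) ℂ) : ℝ :=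
  ∑ α ∈ f.support, ‖f.coeff α‖ ^ 2 * ybWt α

lemma ybI_self {N : ℕ} (f : MvPolynomial (Fin N) ℂ) : ybI f f = (ybN f : ℂ) := by
  rw [ybI_eq, ybN]
  push_cast
  refine Finset.sum_congr rfl fun α _ => ?_
  rw [mul_comm ((starRingEnd ℂ) _), Complex.mul_conj, Complex.normSq_eq_norm_sq]
  push_cast; rfl

lemma ybN_nonneg {N : ℕ} (f : MvPolynomial (Fin N) ℂ) : 0 ≤ ybN f :=
  Finset.sum_nonneg fun α _ => mul_nonneg (sq_nonneg _) (ybWt_pos α).le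

lemma ybN_pos {N : ℕ} (f : MvPolynomial (Fin N) ℂ) (hf : f ≠ 0) : 0 < ybN f := by
  refine Finset.sum_pos (fun α hα => ?_) (MvPolynomial.support_nonempty.mpr hf)
  have : f.coeff α ≠ 0 := MvPolynomial.mem_support_iff.mp hα
  have := ybWt_pos α
  positivity

lemma ybI_monomial {N : ℕ} (s : Fin N →₀ ℕ) (a : ℂ) (g : MvPolynomial (Fin N) ℂ) :
    ybI (MvPolynomial.monomial s a) g = (starRingEnd ℂ) a * g.coeff s * (ybWt s : ℂ) := by
  rw [ybI_eq_of_subset _ g {s} MvPolynomial.support_monomial_subset]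
  simp

lemma ybWt_succ {N : ℕ} (t : Fin N →₀ ℕ) (i : Fin N) :
    ybWt (t + Finsupp.single i 1) = 2 * (t i + 1) * ybWt t := by
  unfold ybWt
  rw [← Finset.mul_prod_erase Finset.univ _ (Finset.mem_univ i),
    ← Finset.mul_prod_erase Finset.univ (fun k => ybW (t k)) (Finset.mem_univ i)]
  have : ∏ k ∈ Finset.univ.erase i, ybW ((t + Finsupp.single i 1 : Fin N →₀ ℕ) k) =
      ∏ k ∈ Finset.univ.erase i, ybW (t k) := by
    refine Finset.prod_congr rfl fun k hk => ?_
    have : k ≠ i := Finset.ne_of_mem_erase hk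
    simp [Finsupp.single_apply, this.symm]
  rw [this]
  simp [ybW_succ]; ring

lemma ybI_adjoint {N : ℕ} (i : Fin N) (f h : MvPolynomial (Fin N) ℂ) :
    ybI f (MvPolynomial.X i * h) = 2 * ybI (MvPolynomial.pderiv i f) h := by
  induction f using MvPolynomial.induction_on' with
  | add p q hp hq => rw [ybI_add_left, hp, hq, map_add, ybI_add_left]; ring
  | monomial s a =>
    rw [MvPolynomial.pderiv_monomial, ybI_monomial, ybI_monomial]
    by_cases hs : s i = 0
    · rw [MvPolynomial.coeff_X_mul']
      simp [hs]
    · obtain ⟨t, rfl⟩ : ∃ t, s = t + Finsupp.single i 1 :=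
        ⟨s - Finsupp.single i 1, by rw [Finsupp.sub_add_single_one_cancel hs]⟩
      rw [add_comm t, MvPolynomial.coeff_X_mul, add_comm, ybWt_succ]
      simp
      ring

/-- The linear rotation on `ℂ^N` mixing coordinates `i` and `j`. -/
noncomputable def ybRot {N : ℕ} (i j : Fin N) : (Fin N → ℂ) →ₗ[ℝ] (Fin N → ℂ) where
  toFun z := fun k => if k = i then ((Real.sqrt 2)⁻¹ : ℝ) * (z i + z j) else
    if k = j then ((Real.sqrt 2)⁻¹ : ℝ) * (z i - z j) else z k
  map_add' x y := by
    funext k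
    simp only [Pi.add_apply]
    split_ifs <;> ring
  map_smul' c x := by
    funext k
    simp only [Pi.smul_apply, RingHom.id_apply]
    split_ifs <;> simp only [Complex.real_smul] <;> ring

lemma yb_s_sq : (((Real.sqrt 2)⁻¹ : ℝ) : ℂ) * (((Real.sqrt 2)⁻¹ : ℝ) : ℂ) = 1 / 2 := by
  rw [← Complex.ofReal_mul, ← mul_inv, Real.mul_self_sqrt (by norm_num)]
  push_cast; norm_num

lemma ybRot_invol {N : ℕ} {i j : Fin N} (hij : i ≠ j) (z : Fin N → ℂ) :
    ybRot i j (ybRot i j z) = z := by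
  have hs := yb_s_sq
  funext k
  simp only [ybRot, LinearMap.coe_mk, AddHom.coe_mk, hij.symm, if_true, if_false]
  split_ifs with h1 h2
  · subst h1; linear_combination (2 * z k) * hs
  · subst h2; linear_combination (2 * z k) * hs
  · rfl

lemma ybRot_measurePreserving {N : ℕ} {i j : Fin N} (hij : i ≠ j) :
    MeasurePreserving (ybRot i j) volume volume := by
  have hcomp : (ybRot i j) ∘ₗ (ybRot i j) = LinearMap.id :=
    LinearMap.ext fun z => ybRot_invol hij z
  have hdet : LinearMap.det (ybRot i j) * LinearMap.det (ybRot i j) = 1 := by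
    rw [← LinearMap.det_comp, hcomp, LinearMap.det_id]
  have habs : |(LinearMap.det (ybRot i j))⁻¹| = 1 := by
    rcases mul_self_eq_one_iff.mp hdet with h | h <;> simp [h]
  refine ⟨(LinearMap.continuous_of_finiteDimensional _).measurable, ?_⟩
  rw [Measure.map_linearMap_addHaar_eq_smul_addHaar _
    (by intro h; rw [h] at hdet; simp at hdet), habs]
  simp

lemma ybRot_weight {N : ℕ} {i j : Fin N} (hij : i ≠ j) (z : Fin N → ℂ) :
    ∏ k, Real.exp (-‖ybRot i j z k‖ ^ 2 / 2) = ∏ k, Real.exp (-‖z k‖ ^ 2 / 2) := by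
  rw [← Real.exp_sum, ← Real.exp_sum]
  congr 1
  have hj : j ∈ Finset.univ.erase i := Finset.mem_erase.mpr ⟨hij.symm, Finset.mem_univ _⟩
  rw [← Finset.add_sum_erase Finset.univ _ (Finset.mem_univ i), ← Finset.add_sum_erase _ _ hj,
    ← Finset.add_sum_erase Finset.univ (fun k => -‖z k‖ ^ 2 / 2) (Finset.mem_univ i),
    ← Finset.add_sum_erase _ (fun k => -‖z k‖ ^ 2 / 2) hj]
  have e : ∑ x ∈ (Finset.univ.erase i).erase j, -‖(ybRot i j) z x‖ ^ 2 / 2 =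
      ∑ x ∈ (Finset.univ.erase i).erase j, -‖z x‖ ^ 2 / 2 := by
    refine Finset.sum_congr rfl fun k hk => ?_
    have h1 : k ≠ j := Finset.ne_of_mem_erase hk
    have h2 : k ≠ i := Finset.ne_of_mem_erase (Finset.mem_of_mem_erase hk)
    simp [ybRot, h1, h2]
  rw [e]
  have e1 : ‖ybRot i j z i‖ ^ 2 + ‖ybRot i j z j‖ ^ 2 = ‖z i‖ ^ 2 + ‖z j‖ ^ 2 := by
    simp only [ybRot, LinearMap.coe_mk, AddHom.coe_mk, hij.symm, if_true, if_false]
    rw [norm_mul, norm_mul, mul_pow, mul_pow, Complex.norm_real, Real.norm_eq_abs, sq_abs, inv_pow,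
      Real.sq_sqrt (by norm_num)]
    have := parallelogram_law_with_norm ℝ (z i) (z j)
    linarith
  linarith

lemma bargmann_rot {N : ℕ} {i j : Fin N} (hij : i ≠ j) (F G : (Fin N → ℂ) → ℂ) :
    bargmannInner N (fun z => F (ybRot i j z)) (fun z => G (ybRot i j z)) =
      bargmannInner N F G := by
  unfold bargmannInner
  let e : (Fin N → ℂ) ≃ₗ[ℝ] (Fin N → ℂ) :=
    LinearEquiv.ofInvolutive (ybRot i j) (ybRot_invol hij)
  have hemb : MeasurableEmbedding (ybRot i j) :=
    e.toContinuousLinearEquiv.toHomeomorph.measurableEmbedding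
  rw [← (ybRot_measurePreserving hij).integral_comp hemb]
  simp_rw [ybRot_weight hij, ybRot_invol hij]

section alg
open MvPolynomial

/-- Substitution of the rotation in polynomials. -/
noncomputable def ybR {N : ℕ} (i j : Fin N) : MvPolynomial (Fin N) ℂ →ₐ[ℂ] MvPolynomial (Fin N) ℂ :=
  aeval (fun k => if k = i then C (((Real.sqrt 2)⁻¹ : ℝ) : ℂ) * (X i + X j) else
    if k = j then C (((Real.sqrt 2)⁻¹ : ℝ) : ℂ) * (X i - X j) else X k)

/-- `δ_{ij}` without its prefactor. -/
noncomputable def ybD {N : ℕ} (i j : Fin N) : MvPolynomial (Fin N) ℂ →ₐ[ℂ] MvPolynomial (Fin N) ℂ :=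
  aeval (fun k => if k = i ∨ k = j then C (1 / 2) * (X i + X j) else X k)

/-- Diagonal substitution in the variable `j`. -/
noncomputable def ybDg {N : ℕ} (j : Fin N) (c : ℂ) :
    MvPolynomial (Fin N) ℂ →ₐ[ℂ] MvPolynomial (Fin N) ℂ :=
  aeval (fun k => if k = j then C c * X k else X k)

/-- Relative angular momentum of the pair `i, j`. -/
noncomputable def ybL {N : ℕ} (i j : Fin N) (f : MvPolynomial (Fin N) ℂ) :
    MvPolynomial (Fin N) ℂ :=
  C (1 / 2) * (X i - X j) * (pderiv i f - pderiv j f)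

lemma ybR_eval {N : ℕ} (i j : Fin N) (f : MvPolynomial (Fin N) ℂ) (z : Fin N → ℂ) :
    eval z (ybR i j f) = eval (ybRot i j z) f := by
  induction f using MvPolynomial.induction_on with
  | C a => simp [ybR]
  | add p q hp hq => rw [map_add, map_add, map_add, hp, hq]
  | mul_X p k hp =>
    rw [map_mul, map_mul, map_mul, hp]
    congr 1
    simp only [ybR, aeval_X, eval_X, ybRot, LinearMap.coe_mk, AddHom.coe_mk]
    split_ifs <;> simp

lemma ybI_rot {N : ℕ} {i j : Fin N} (hij : i ≠ j) (f g : MvPolynomial (Fin N) ℂ) :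
    ybI (ybR i j f) (ybR i j g) = ybI f g := by
  unfold ybI
  simp_rw [ybR_eval]
  exact bargmann_rot hij (fun z => eval z f) (fun z => eval z g)

lemma ybD_eval {N : ℕ} (i j : Fin N) (f : MvPolynomial (Fin N) ℂ) (z : Fin N → ℂ) :
    eval z (ybD i j f) =
      eval (Function.update (Function.update z i ((z i + z j) / 2)) j ((z i + z j) / 2)) f := by
  induction f using MvPolynomial.induction_on with
  | C a => simp [ybD]
  | add p q hp hq => rw [map_add, map_add, map_add, hp, hq]
  | mul_X p k hp =>
    rw [map_mul, map_mul, map_mul, hp]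
    congr 1
    simp only [ybD, aeval_X, eval_X, Function.update_apply]
    by_cases h1 : k = j <;> by_cases h2 : k = i <;> simp [h1, h2] <;> (try ring) <;> (try simp_all)

lemma ybR_ybD {N : ℕ} {i j : Fin N} (hij : i ≠ j) (f : MvPolynomial (Fin N) ℂ) :
    ybR i j (ybD i j f) = ybDg j 0 (ybR i j f) := by
  have h : (ybR i j).comp (ybD i j) = (ybDg j 0).comp (ybR i j) := by
    apply MvPolynomial.algHom_ext
    intro k
    simp only [AlgHom.comp_apply, ybR, ybD, ybDg, aeval_X]
    have h2 : (C (1 / 2 : ℂ) : MvPolynomial (Fin N) ℂ) * 2 = 1 := by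
      rw [← map_ofNat C, ← C_mul]; norm_num
    by_cases h1 : k = i
    · simp [h1, hij, hij.symm]
      simp at h2
      linear_combination (C (↑√2)⁻¹ * X i) * h2
    · by_cases h3 : k = j
      · simp [h3, hij, hij.symm]
        simp at h2
        linear_combination (C (↑√2)⁻¹ * X i) * h2
      · simp [h1, h3]
  exact DFunLike.congr_fun h f

lemma ybR_swap {N : ℕ} {i j : Fin N} (hij : i ≠ j) (f : MvPolynomial (Fin N) ℂ) :
    ybR i j (rename (Equiv.swap i j) f) = ybDg j (-1) (ybR i j f) := by
  have h : (ybR i j).comp (rename (Equiv.swap i j)) = (ybDg j (-1)).comp (ybR i j) := by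
    apply MvPolynomial.algHom_ext
    intro k
    simp only [AlgHom.comp_apply, ybR, ybDg, aeval_X, rename_X]
    by_cases h1 : k = i
    · simp [h1, hij, hij.symm]
      ring
    · by_cases h3 : k = j
      · simp [h3, hij, hij.symm]
      · simp [h1, h3, Equiv.swap_apply_of_ne_of_ne]
  exact DFunLike.congr_fun h f

lemma ybDg_coeff {N : ℕ} (j : Fin N) (c : ℂ) (g : MvPolynomial (Fin N) ℂ) (α : Fin N →₀ ℕ) :
    (ybDg j c g).coeff α = c ^ (α j) * g.coeff α := by
  induction g using MvPolynomial.induction_on' with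
  | add p q hp hq => rw [map_add, coeff_add, coeff_add, hp, hq]; ring
  | monomial s a =>
    have : ybDg j c (monomial s a) = monomial s (c ^ (s j) * a) := by
      rw [monomial_eq, monomial_eq, map_mul, Finsupp.prod_fintype _ _ (by simp)]
      simp only [ybDg, map_prod, map_pow, aeval_X, algHom_C]
      have : ∀ k, (if k = j then C c * X k else X k : MvPolynomial (Fin N) ℂ) ^ s k =
          (if k = j then C (c ^ s k) else 1) * X k ^ s k := by
        intro k
        split_ifs
        · rw [mul_pow, C_pow]
        · rw [one_mul]
      simp_rw [this, Finset.prod_mul_distrib]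
      simp
      ring
    rw [this, coeff_monomial, coeff_monomial]
    split_ifs with h
    · rw [h]
    · simp

lemma yb_coeff_X_pderiv {N : ℕ} (j : Fin N) (g : MvPolynomial (Fin N) ℂ) (α : Fin N →₀ ℕ) :
    (X j * pderiv j g).coeff α = (α j : ℂ) * g.coeff α := by
  induction g using MvPolynomial.induction_on' with
  | add p q hp hq => rw [map_add, mul_add, coeff_add, coeff_add, hp, hq]; ring
  | monomial s a =>
    rw [X_mul_pderiv_monomial, coeff_smul, coeff_monomial]
    split_ifs with h
    · simp [h]
    · simp

lemma ybR_ybL {N : ℕ} {i j : Fin N} (hij : i ≠ j) (f : MvPolynomial (Fin N) ℂ) :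
    ybR i j (ybL i j f) = X j * pderiv j (ybR i j f) := by
  have hs : (C (((Real.sqrt 2)⁻¹ : ℝ) : ℂ) : MvPolynomial (Fin N) ℂ) * C (((Real.sqrt 2)⁻¹ : ℝ) : ℂ)
      = C (1 / 2) := by rw [← C_mul, yb_s_sq]
  have h2 : (C (1 / 2 : ℂ) : MvPolynomial (Fin N) ℂ) * 2 = 1 := by
    rw [← map_ofNat C, ← C_mul]; norm_num
  induction f using MvPolynomial.induction_on with
  | C a => simp [ybL, ybR]
  | add p q hp hq =>
    have : ybL i j (p + q) = ybL i j p + ybL i j q := by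
      simp only [ybL, map_add]; ring
    rw [this, map_add, hp, hq, map_add, map_add]; ring
  | mul_X p k hp =>
    have e : ybL i j (p * X k) = ybL i j p * X k + p * ybL i j (X k) := by
      simp only [ybL, pderiv_mul]; ring
    have e2 : ybR i j (ybL i j (X k)) = X j * pderiv j (ybR i j (X k)) := by
      unfold ybL
      rw [pderiv_X, pderiv_X]
      simp only [ybR, map_mul, map_sub, aeval_X, algHom_C, if_true, hij.symm, if_false]
      by_cases h1 : k = i
      · subst h1
        simp [hij, hij.symm]
        simp at h2
        linear_combination (C (↑√2)⁻¹ * X j) * h2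
      · by_cases h3 : k = j
        · subst h3
          simp [hij, hij.symm]
          simp at h2
          linear_combination (C (↑√2)⁻¹ * X k) * h2
        · simp [h1, h3]
    rw [e, map_add, map_mul, map_mul, hp, e2, map_mul, pderiv_mul]
    ring

lemma ybR_even {N : ℕ} {i j : Fin N} (hij : i ≠ j) (f : MvPolynomial (Fin N) ℂ)
    (hf : f.IsSymmetric) (α : Fin N →₀ ℕ) (hα : α ∈ (ybR i j f).support) : Even (α j) := by
  have h := ybR_swap hij f
  rw [hf] at h
  have h2 := congrArg (coeff α) h
  rw [ybDg_coeff] at h2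
  by_contra hodd
  rw [Nat.not_even_iff_odd] at hodd
  rw [hodd.neg_one_pow] at h2
  have : coeff α (ybR i j f) = 0 := by linear_combination h2 / 2
  exact (mem_support_iff.mp hα) this

/-- Weighted sums with a diagonal operator. -/
lemma ybI_diag {N : ℕ} (g h : MvPolynomial (Fin N) ℂ) (m : (Fin N →₀ ℕ) → ℝ)
    (hm : ∀ α, h.coeff α = (m α : ℂ) * g.coeff α) :
    ybI g h = ((∑ α ∈ g.support, m α * (‖g.coeff α‖ ^ 2 * ybWt α) : ℝ) : ℂ) := by
  rw [ybI_eq]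
  push_cast
  refine Finset.sum_congr rfl fun α _ => ?_
  rw [hm]
  have : (starRingEnd ℂ) (coeff α g) * coeff α g = (‖g.coeff α‖ : ℂ) ^ 2 := by
    rw [mul_comm ((starRingEnd ℂ) _), Complex.mul_conj, Complex.normSq_eq_norm_sq]
    push_cast; rfl
  rw [← this]; ring

lemma yb_pair_D {N : ℕ} {i j : Fin N} (hij : i ≠ j) (f : MvPolynomial (Fin N) ℂ) :
    ybI f (ybD i j f) = ((∑ α ∈ (ybR i j f).support,
      (0 : ℝ) ^ (α j) * (‖(ybR i j f).coeff α‖ ^ 2 * ybWt α) : ℝ) : ℂ) := by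
  rw [← ybI_rot hij, ybR_ybD hij]
  apply ybI_diag
  intro α
  rw [ybDg_coeff]; push_cast; rfl

lemma yb_pair_L {N : ℕ} {i j : Fin N} (hij : i ≠ j) (f : MvPolynomial (Fin N) ℂ) :
    ybI f (ybL i j f) = ((∑ α ∈ (ybR i j f).support,
      (α j : ℝ) * (‖(ybR i j f).coeff α‖ ^ 2 * ybWt α) : ℝ) : ℂ) := by
  rw [← ybI_rot hij, ybR_ybL hij]
  apply ybI_diag
  intro α
  rw [yb_coeff_X_pderiv]; push_cast; rfl

lemma yb_pair_N {N : ℕ} {i j : Fin N} (hij : i ≠ j) (f : MvPolynomial (Fin N) ℂ) :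
    ybN f = ybN (ybR i j f) := by
  have := ybI_rot hij f f
  rw [ybI_self, ybI_self] at this
  exact_mod_cast this.symm

lemma yb_pair_le {N : ℕ} {i j : Fin N} (hij : i ≠ j) (f : MvPolynomial (Fin N) ℂ)
    (hf : f.IsSymmetric) :
    ybN f - (1 / 2) * (ybI f (ybL i j f)).re ≤ (ybI f (ybD i j f)).re := by
  rw [yb_pair_D hij, yb_pair_L hij, yb_pair_N hij, Complex.ofReal_re, Complex.ofReal_re, ybN,
    Finset.mul_sum, ← Finset.sum_sub_distrib]
  refine Finset.sum_le_sum fun α hα => ?_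
  have hw : 0 ≤ ‖(ybR i j f).coeff α‖ ^ 2 * ybWt α := mul_nonneg (sq_nonneg _) (ybWt_pos α).le
  obtain ⟨m, hm⟩ := ybR_even hij f hf α hα
  rcases Nat.eq_zero_or_pos m with h0 | h0
  · rw [hm, h0]; simp
  · have h1 : (1 : ℝ) ≤ m := by exact_mod_cast h0
    rw [hm, zero_pow (by omega)]
    push_cast
    nlinarith

lemma yb_pair_eq {N : ℕ} {i j : Fin N} (hij : i ≠ j) (f : MvPolynomial (Fin N) ℂ)
    (hf : f.IsSymmetric) (hdeg : (ybR i j f).degreeOf j ≤ 2) :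
    ybI f (ybD i j f) = (ybN f : ℂ) - (1 / 2) * ybI f (ybL i j f) := by
  rw [yb_pair_D hij, yb_pair_L hij, yb_pair_N hij, ybN]
  have : ∀ x y z : ℝ, x = y - (1/2) * z → (x : ℂ) = y - (1/2) * z := by
    intro x y z h; rw [h]; push_cast; rfl
  apply this
  rw [Finset.mul_sum, ← Finset.sum_sub_distrib]
  refine Finset.sum_congr rfl fun α hα => ?_
  obtain ⟨m, hm⟩ := ybR_even hij f hf α hα
  have h2 : α j ≤ 2 := degreeOf_le_iff.mp hdeg α hα
  have : m = 0 ∨ m = 1 := by omega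
  rcases this with h0 | h0
  · rw [hm, h0]; simp
  · rw [hm, h0]; norm_num; ring

lemma yb_pair_small {N L : ℕ} (hL : L ≤ 1) {i j : Fin N} (hij : i ≠ j)
    (f : MvPolynomial (Fin N) ℂ)
    (hf : f.IsSymmetric) (hh : f.IsHomogeneous L) :
    ybI f (ybD i j f) = (ybN f : ℂ) := by
  rw [yb_pair_D hij, yb_pair_N hij, ybN]
  congr 1
  refine Finset.sum_congr rfl fun α hα => ?_
  have hR : (ybR i j f).IsHomogeneous (1 * L) := by
    apply hh.aeval
    intro k
    have hX : ∀ k : Fin N, (X k : MvPolynomial (Fin N) ℂ).IsHomogeneous 1 := isHomogeneous_X _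
    split_ifs
    · simpa using (isHomogeneous_C (Fin N) _).mul ((hX i).add (hX j))
    · simpa using (isHomogeneous_C (Fin N) _).mul ((hX i).sub (hX j))
    · exact hX k
  have h1 : (ybR i j f).degreeOf j ≤ 1 :=
    (degreeOf_le_totalDegree _ _).trans (hR.totalDegree_le.trans (by omega))
  have h2 : α j ≤ 1 := degreeOf_le_iff.mp h1 α hα
  obtain ⟨m, hm⟩ := ybR_even hij f hf α hα
  have : α j = 0 := by omega
  rw [this]; simp

end alg

section fin
open MvPolynomial

lemma yb_pair_sum {N : ℕ} {M : Type*} [AddCommMonoid M] (h : Fin N → Fin N → M)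
    (hsymm : ∀ i j, h i j = h j i) (hdiag : ∀ i, h i i = 0) :
    2 • (∑ p ∈ Finset.univ.filter (fun p : Fin N × Fin N => p.1 < p.2), h p.1 p.2) =
      ∑ i, ∑ j, h i j := by
  have e1 : (∑ p ∈ Finset.univ.filter (fun p : Fin N × Fin N => p.1 < p.2), h p.1 p.2) =
      ∑ i, ∑ j, if i < j then h i j else 0 := by
    rw [Finset.sum_filter, Fintype.sum_prod_type]
  have e2 : (∑ p ∈ Finset.univ.filter (fun p : Fin N × Fin N => p.1 < p.2), h p.1 p.2) =
      ∑ i, ∑ j, if j < i then h i j else 0 := by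
    rw [e1, Finset.sum_comm]
    refine Finset.sum_congr rfl fun i _ => Finset.sum_congr rfl fun j _ => ?_
    rw [hsymm]
  rw [two_nsmul]
  nth_rewrite 1 [e1]
  rw [e2, ← Finset.sum_add_distrib]
  refine Finset.sum_congr rfl fun i _ => ?_
  rw [← Finset.sum_add_distrib]
  refine Finset.sum_congr rfl fun j _ => ?_
  rcases lt_trichotomy i j with hlt | heq | hgt
  · simp [hlt, hlt.not_gt]
  · subst heq; simp [hdiag]
  · simp [hgt, hgt.not_gt]

/-- The set of pairs. -/
noncomputable def ybPairs (N : ℕ) : Finset (Fin N × Fin N) :=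
  Finset.univ.filter (fun p : Fin N × Fin N => p.1 < p.2)

lemma ybPairs_card (N : ℕ) : ((ybPairs N).card : ℝ) = (N : ℝ) * ((N : ℝ) - 1) / 2 := by
  have h := yb_pair_sum (N := N) (fun i j => if i = j then (0 : ℝ) else 1)
    (fun i j => by simp [eq_comm]) (fun i => by simp)
  have e : (∑ p ∈ Finset.univ.filter (fun p : Fin N × Fin N => p.1 < p.2),
      if p.1 = p.2 then (0 : ℝ) else 1) = (ybPairs N).card := by
    rw [Finset.card_eq_sum_ones, Nat.cast_sum]
    refine Finset.sum_congr rfl fun p hp => ?_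
    have := (Finset.mem_filter.mp hp).2
    simp [this.ne]
  rw [e] at h
  have e2 : ∀ i : Fin N, ∑ j : Fin N, (if i = j then (0 : ℝ) else 1) = (N : ℝ) - 1 := by
    intro i
    have : ∀ j : Fin N, (if i = j then (0 : ℝ) else 1) = 1 - (if i = j then 1 else 0) := by
      intro j; split_ifs <;> norm_num
    simp_rw [this, Finset.sum_sub_distrib]
    simp
  simp_rw [e2] at h
  simp at h
  linarith

lemma yb_sum_L {N L : ℕ} (f : MvPolynomial (Fin N) ℂ) (hh : f.IsHomogeneous L) :
    2 * ∑ p ∈ ybPairs N, ybL p.1 p.2 f =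
      C ((N : ℂ) * L) * f - (∑ k, X k) * (∑ k, pderiv k f) := by
  have h := yb_pair_sum (fun i j => ybL i j f) (fun i j => by simp only [ybL]; ring)
    (fun i => by simp [ybL])
  rw [two_nsmul, ← two_mul] at h
  rw [ybPairs, h]
  have heul := hh.sum_X_mul_pderiv
  have e : ∀ i j : Fin N, ybL i j f = C (1 / 2) * (X i * pderiv i f) + C (1 / 2) * (X j * pderiv j f)
      - C (1 / 2) * (X i * pderiv j f) - C (1 / 2) * (X j * pderiv i f) := by
    intro i j; simp only [ybL]; ring
  have h2 : (C (1 / 2 : ℂ) : MvPolynomial (Fin N) ℂ) * 2 = 1 := by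
    rw [← map_ofNat C, ← C_mul]; norm_num
  simp_rw [e, Finset.sum_sub_distrib, Finset.sum_add_distrib, ← Finset.mul_sum]
  have e3 : ∑ i : Fin N, ∑ j : Fin N, X i * pderiv i f = (N : MvPolynomial (Fin N) ℂ) * (L * f) := by
    simp only [Finset.sum_const, Finset.card_univ, Fintype.card_fin, nsmul_eq_mul]
    rw [← Finset.mul_sum, heul]; simp
  have e4 : ∑ i : Fin N, ∑ j : Fin N, X j * pderiv j f = (N : MvPolynomial (Fin N) ℂ) * (L * f) := by
    simp [heul]
  have e5 : ∑ i : Fin N, ∑ j : Fin N, X i * pderiv j f = (∑ k, X k) * (∑ k, pderiv k f) := by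
    rw [Finset.sum_mul_sum]
  have e6 : ∑ i : Fin N, ∑ j : Fin N, X j * pderiv i f = (∑ k, X k) * (∑ k, pderiv k f) := by
    rw [Finset.sum_comm, Finset.sum_mul_sum]
  simp only [← Finset.mul_sum] at e3 e4 e5 e6 ⊢
  have hC : (C ((N : ℂ) * L) : MvPolynomial (Fin N) ℂ) = N * L := by simp
  rw [e4, e3, e5, e6, hC]
  linear_combination ((N : MvPolynomial (Fin N) ℂ) * L * f - (∑ k, X k) * (∑ k, pderiv k f)) * h2

lemma yb_inner_L {N L : ℕ} (f : MvPolynomial (Fin N) ℂ) (hh : f.IsHomogeneous L) :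
    2 * ∑ p ∈ ybPairs N, ybI f (ybL p.1 p.2 f) =
      (N : ℂ) * L * ybN f - 2 * ybN (∑ k, pderiv k f) := by
  rw [← ybI_sum_right]
  have h := congrArg (ybI f) (yb_sum_L f hh)
  rw [← map_ofNat C, ybI_C_mul_right, ybI_sub_right, ybI_C_mul_right, ybI_self,
    Finset.sum_mul, ybI_sum_right f Finset.univ] at h
  simp_rw [ybI_adjoint, ← Finset.mul_sum, ← ybI_sum_left, ybI_self] at h
  exact h

lemma yb_DeltaN {N : ℕ} (f : MvPolynomial (Fin N) ℂ) :
    bargmannInner N (fun z => MvPolynomial.eval z f) (DeltaN N (fun z => MvPolynomial.eval z f)) =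
      (((2 * π) ^ (-(3:ℝ) / 2) : ℝ) : ℂ) * ∑ p ∈ ybPairs N, ybI f (ybD p.1 p.2 f) := by
  have : DeltaN N (fun z => MvPolynomial.eval z f) = fun z => eval z
      (C (((2 * π) ^ (-(3:ℝ) / 2) : ℝ) : ℂ) * ∑ p ∈ ybPairs N, ybD p.1 p.2 f) := by
    funext z
    rw [DeltaN, map_mul, eval_C, map_sum, Finset.mul_sum]
    refine Finset.sum_congr rfl fun p _ => ?_
    rw [ybD_eval, deltaPair]
  rw [this, ← ybI_sum_right, ← ybI_C_mul_right]
  rfl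

lemma yb_ne_of_mem {N : ℕ} {p : Fin N × Fin N} (hp : p ∈ ybPairs N) : p.1 ≠ p.2 :=
  (Finset.mem_filter.mp hp).2.ne

lemma yb_lower {N L : ℕ} (f : MvPolynomial (Fin N) ℂ) (hf : f.IsSymmetric)
    (hh : f.IsHomogeneous L) :
    (((N : ℝ) / 2) * ((N : ℝ) - 1 - (L : ℝ) / 2)) * ybN f ≤
      (∑ p ∈ ybPairs N, ybI f (ybD p.1 p.2 f)).re := by
  have h1 : ∑ p ∈ ybPairs N, (ybN f - (1 / 2) * (ybI f (ybL p.1 p.2 f)).re) ≤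
      ∑ p ∈ ybPairs N, (ybI f (ybD p.1 p.2 f)).re :=
    Finset.sum_le_sum fun p hp => yb_pair_le (yb_ne_of_mem hp) f hf
  rw [Finset.sum_sub_distrib, ← Finset.mul_sum, Finset.sum_const, nsmul_eq_mul, ybPairs_card,
    ← Complex.re_sum, ← Complex.re_sum] at h1
  have h2 := congrArg Complex.re (yb_inner_L f hh)
  have h3 : 2 * (∑ p ∈ ybPairs N, ybI f (ybL p.1 p.2 f)).re =
      (N : ℝ) * L * ybN f - 2 * ybN (∑ k, pderiv k f) := by
    simpa using h2
  have h4 := ybN_nonneg (∑ k, pderiv k f)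
  nlinarith

lemma yb_upper {N L : ℕ} (f : MvPolynomial (Fin N) ℂ) (hf : f.IsSymmetric)
    (hh : f.IsHomogeneous L) (hT : ∑ k, pderiv k f = 0)
    (hdeg : ∀ i j : Fin N, i ≠ j → (ybR i j f).degreeOf j ≤ 2) :
    (∑ p ∈ ybPairs N, ybI f (ybD p.1 p.2 f)) =
      ((((N : ℝ) / 2) * ((N : ℝ) - 1 - (L : ℝ) / 2) : ℝ) : ℂ) * ybN f := by
  have h1 : ∑ p ∈ ybPairs N, ybI f (ybD p.1 p.2 f) =
      ∑ p ∈ ybPairs N, ((ybN f : ℂ) - (1 / 2) * ybI f (ybL p.1 p.2 f)) :=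
    Finset.sum_congr rfl fun p hp =>
      yb_pair_eq (yb_ne_of_mem hp) f hf (hdeg _ _ (yb_ne_of_mem hp))
  have hc : (((ybPairs N).card : ℂ)) = (N : ℂ) * ((N : ℂ) - 1) / 2 := by
    exact_mod_cast congrArg (fun x : ℝ => (x : ℂ)) (ybPairs_card N)
  rw [h1, Finset.sum_sub_distrib, ← Finset.mul_sum, Finset.sum_const, nsmul_eq_mul, hc]
  have h2 := yb_inner_L f hh
  rw [hT] at h2
  have h0 : ybN (0 : MvPolynomial (Fin N) ℂ) = 0 := by simp [ybN]
  rw [h0] at h2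
  push_cast at h2 ⊢
  linear_combination (-1/4) * h2

lemma yb_small {N L : ℕ} (hL : L ≤ 1) (f : MvPolynomial (Fin N) ℂ) (hf : f.IsSymmetric)
    (hh : f.IsHomogeneous L) :
    (∑ p ∈ ybPairs N, ybI f (ybD p.1 p.2 f)) =
      (((N : ℝ) * ((N : ℝ) - 1) / 2 : ℝ) : ℂ) * ybN f := by
  rw [Finset.sum_congr rfl fun p hp => yb_pair_small hL (yb_ne_of_mem hp) f hf hh,
    Finset.sum_const, nsmul_eq_mul, ← ybPairs_card]
  push_cast; rfl

/-- Centered variables. -/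
noncomputable def ybY {N : ℕ} (k : Fin N) : MvPolynomial (Fin N) ℂ :=
  X k - C ((N : ℂ)⁻¹) * ∑ l, X l

/-- The minimizer. -/
noncomputable def ybF (N L : ℕ) : MvPolynomial (Fin N) ℂ :=
  aeval ybY (esymm (Fin N) ℂ L)

lemma ybF_eq (N L : ℕ) : ybF N L = ∑ S ∈ Finset.powersetCard L Finset.univ, ∏ k ∈ S, ybY k := by
  simp [ybF, esymm, map_sum, map_prod]

lemma ybF_symm (N L : ℕ) : (ybF N L).IsSymmetric := by
  intro e
  have h1 : ∀ k, rename e (ybY k : MvPolynomial (Fin N) ℂ) = ybY (e k) := by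
    intro k
    simp only [ybY, map_sub, map_mul, map_sum, rename_X, rename_C]
    rw [Equiv.sum_comp e (fun l => (X l : MvPolynomial (Fin N) ℂ))]
  have h2 : (rename e).comp (aeval (ybY : Fin N → MvPolynomial (Fin N) ℂ)) =
      (aeval ybY).comp (rename e) := by
    apply MvPolynomial.algHom_ext
    intro k
    simp [h1]
  have h3 := DFunLike.congr_fun h2 (esymm (Fin N) ℂ L)
  simp only [AlgHom.comp_apply, rename_esymm] at h3
  exact h3

lemma ybY_hom {N : ℕ} (k : Fin N) : (ybY k : MvPolynomial (Fin N) ℂ).IsHomogeneous 1 := by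
  have hX : ∀ k : Fin N, (X k : MvPolynomial (Fin N) ℂ).IsHomogeneous 1 := isHomogeneous_X _
  refine (hX k).sub ?_
  simpa using (isHomogeneous_C (Fin N) _).mul
    (IsHomogeneous.sum Finset.univ _ 1 (fun l _ => hX l))

lemma ybF_hom (N L : ℕ) : (ybF N L).IsHomogeneous L := by
  rw [ybF_eq]
  refine IsHomogeneous.sum _ _ _ fun S hS => ?_
  have := IsHomogeneous.prod S (fun k => (ybY k : MvPolynomial (Fin N) ℂ)) (fun _ => 1)
    (fun k _ => ybY_hom k)
  simpa [(Finset.mem_powersetCard.mp hS).2] using this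

lemma ybF_transl {N L : ℕ} (hN : N ≠ 0) : ∑ k, pderiv k (ybF N L) = 0 := by
  have hN' : (N : ℂ) ≠ 0 := Nat.cast_ne_zero.mpr hN
  have key : ∀ p : MvPolynomial (Fin N) ℂ, ∑ k, pderiv k (aeval ybY p) = 0 := by
    intro p
    induction p using MvPolynomial.induction_on with
    | C a => simp
    | add p q hp hq => simp only [map_add, Finset.sum_add_distrib, hp, hq, add_zero]
    | mul_X p k hp =>
      have hk : ∑ l, pderiv l (ybY k : MvPolynomial (Fin N) ℂ) = 0 := by
        have : ∀ l, pderiv l (ybY k : MvPolynomial (Fin N) ℂ) =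
            (if k = l then 1 else 0) - C ((N : ℂ)⁻¹) := by
          intro l
          simp only [ybY, map_sub, pderiv_C_mul, map_sum, pderiv_X, Pi.single_apply]
          simp
        simp_rw [this, Finset.sum_sub_distrib]
        have hc : (N : MvPolynomial (Fin N) ℂ) * C ((N : ℂ)⁻¹) = 1 := by
          rw [← map_natCast C, ← C_mul, mul_inv_cancel₀ hN', C_1]
        simp [hc]
      simp only [map_mul, aeval_X, pderiv_mul, Finset.sum_add_distrib]
      rw [← Finset.sum_mul, ← Finset.mul_sum, hp, hk]; simp
  exact key _

lemma ybR_sumX {N : ℕ} {i j : Fin N} (hij : i ≠ j) :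
    degreeOf j (ybR i j (∑ l, X l)) = 0 := by
  have hj : j ∈ Finset.univ.erase i := Finset.mem_erase.mpr ⟨hij.symm, Finset.mem_univ _⟩
  have e : ybR i j (∑ l, X l) = C (2 * (((Real.sqrt 2)⁻¹ : ℝ) : ℂ)) * X i +
      ∑ l ∈ (Finset.univ.erase i).erase j, X l := by
    rw [map_sum, ← Finset.add_sum_erase Finset.univ _ (Finset.mem_univ i),
      ← Finset.add_sum_erase _ _ hj, ← add_assoc]
    congr 1
    · simp only [ybR, aeval_X, if_true, hij.symm, if_false, C_mul, map_ofNat]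
      ring
    · refine Finset.sum_congr rfl fun k hk => ?_
      have h1 : k ≠ j := Finset.ne_of_mem_erase hk
      have h2 : k ≠ i := Finset.ne_of_mem_erase (Finset.mem_of_mem_erase hk)
      simp [ybR, h1, h2]
  rw [e, ← Nat.le_zero]
  refine (degreeOf_add_le _ _ _).trans (max_le ?_ ?_)
  · refine (degreeOf_C_mul_le _ _ _).trans ?_
    rw [degreeOf_X_of_ne hij.symm]
  · refine (degreeOf_sum_le _ _ _).trans (Finset.sup_le fun l hl => ?_)
    rw [degreeOf_X_of_ne (Finset.ne_of_mem_erase hl).symm]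

lemma ybR_Y {N : ℕ} {i j : Fin N} (hij : i ≠ j) (k : Fin N) :
    degreeOf j (ybR i j (ybY k)) ≤ if k ∈ ({i, j} : Finset (Fin N)) then 1 else 0 := by
  have h2 : degreeOf j (ybR i j (X k)) ≤ if k ∈ ({i, j} : Finset (Fin N)) then 1 else 0 := by
    have hij1 : degreeOf j (X i : MvPolynomial (Fin N) ℂ) ≤ 1 := by
      rw [degreeOf_X_of_ne hij.symm]; omega
    have hjj : degreeOf j (X j : MvPolynomial (Fin N) ℂ) ≤ 1 := by
      rw [degreeOf_X_self]
    simp only [ybR, aeval_X, Finset.mem_insert, Finset.mem_singleton]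
    by_cases h1 : k = i
    · simp only [h1, if_true, true_or]
      exact (degreeOf_C_mul_le _ _ _).trans ((degreeOf_add_le _ _ _).trans (max_le hij1 hjj))
    · by_cases h3 : k = j
      · simp only [h3, if_true, or_true, hij.symm, if_false]
        exact (degreeOf_C_mul_le _ _ _).trans ((degreeOf_sub_le _ _ _).trans (max_le hij1 hjj))
      · simp only [h1, h3, if_false, or_false]
        rw [degreeOf_X_of_ne (Ne.symm h3)]
  rw [ybY, map_sub, map_mul]
  refine (degreeOf_sub_le _ _ _).trans (max_le h2 ?_)
  have e : ybR i j (C ((N : ℂ)⁻¹)) = C ((N : ℂ)⁻¹) := by simp [ybR]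
  rw [e]
  refine (degreeOf_C_mul_le _ _ _).trans ?_
  rw [ybR_sumX hij]; exact Nat.zero_le _

lemma ybF_deg {N L : ℕ} {i j : Fin N} (hij : i ≠ j) : degreeOf j (ybR i j (ybF N L)) ≤ 2 := by
  rw [ybF_eq, map_sum]
  refine (degreeOf_sum_le _ _ _).trans (Finset.sup_le fun S _ => ?_)
  rw [map_prod]
  refine (degreeOf_prod_le _ _ _).trans ?_
  refine (Finset.sum_le_sum fun k _ => ybR_Y hij k).trans ?_
  rw [Finset.sum_ite_mem, Finset.sum_const, smul_eq_mul, mul_one]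
  exact (Finset.card_le_card Finset.inter_subset_right).trans Finset.card_le_two

lemma ybF_ne_zero {N L : ℕ} (hL2 : 2 ≤ L) (hL : L ≤ N) : ybF N L ≠ 0 := by
  obtain ⟨ζ, hζ⟩ : ∃ ζ : ℂ, IsPrimitiveRoot ζ L :=
    ⟨_, Complex.isPrimitiveRoot_exp L (by omega)⟩
  let x : Fin N → ℂ := fun k => if (k : ℕ) < L then ζ ^ (k : ℕ) else 0
  have hsum : ∑ k, x k = 0 := by
    have h1 : ∑ k, x k = ∑ k ∈ Finset.range N, if k < L then ζ ^ k else 0 :=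
      Fin.sum_univ_eq_sum_range (fun k => if k < L then ζ ^ k else 0) N
    rw [h1, ← Finset.sum_filter]
    have h2 : (Finset.range N).filter (· < L) = Finset.range L := by
      ext a; simp; omega
    rw [h2, hζ.geom_sum_eq_zero (by omega)]
  intro h0
  have h := congrArg (eval x) h0
  rw [ybF_eq, map_zero, map_sum] at h
  have hy : ∀ k, eval x (ybY k) = x k := by
    intro k
    simp [ybY, hsum]
  simp_rw [map_prod, hy] at h
  let T : Finset (Fin N) := Finset.univ.filter (fun k => (k : ℕ) < L)
  have hT : T.card = L := by
    have : T.card = Fintype.card {k : Fin N // (k : ℕ) < L} := by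
      rw [Fintype.card_subtype]
    rw [Fin.card_filter_val_lt]
    omega
  rw [Finset.sum_eq_single T] at h
  · rw [Finset.prod_eq_zero_iff] at h
    obtain ⟨k, hk, hk0⟩ := h
    have : (k : ℕ) < L := (Finset.mem_filter.mp hk).2
    simp only [x, this, if_true] at hk0
    exact hζ.ne_zero (by omega) (by by_contra hz; exact pow_ne_zero _ hz hk0)
  · intro S hS hne
    have : ∃ k ∈ S, k ∉ T := by
      by_contra hcon
      push Not at hcon
      exact hne (Finset.eq_of_subset_of_card_le hcon
        (by rw [hT, (Finset.mem_powersetCard.mp hS).2]))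
    obtain ⟨k, hk, hkT⟩ := this
    refine Finset.prod_eq_zero hk ?_
    have : ¬ (k : ℕ) < L := fun hlt => hkT (Finset.mem_filter.mpr ⟨Finset.mem_univ _, hlt⟩)
    simp [x, this]
  · intro hnot
    exact absurd (Finset.mem_powersetCard.mpr ⟨Finset.subset_univ _, hT⟩) hnot

end fin

/-- Yrast curve for small angular momentum: for all `N ≥ 2` and integers
`0 ≤ L ≤ N`, `Δ_N(L) = (2π)^{−3/2} N(N−1)/2` for `L ∈ {0,1}` and
`Δ_N(L) = (2π)^{−3/2} (N/2)(N − 1 − L/2)` for `2 ≤ L ≤ N`. -/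
theorem yrast_small_angular_momentum (N L : ℕ) (hN : 2 ≤ N) (hL : L ≤ N) :
    (L = 0 ∨ L = 1 →
      yrast N L = (2 * π) ^ (-(3:ℝ) / 2) * ((N : ℝ) * ((N : ℝ) - 1) / 2)) ∧
    (2 ≤ L →
      yrast N L = (2 * π) ^ (-(3:ℝ) / 2) *
        (((N : ℝ) / 2) * ((N : ℝ) - 1 - (L : ℝ) / 2))) := by
  have hK : 0 < (2 * π) ^ (-(3:ℝ) / 2) := Real.rpow_pos_of_pos (by positivity) _
  -- membership from an exact eigen-identity
  have mem : ∀ (f : MvPolynomial (Fin N) ℂ) (v : ℝ), f ≠ 0 →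
      (∑ p ∈ ybPairs N, ybI f (ybD p.1 p.2 f)) = (v : ℂ) * ybN f →
      ((((2 * π) ^ (-(3:ℝ) / 2) * v : ℝ)) : ℂ) =
        bargmannInner N (fun z => MvPolynomial.eval z f)
          (DeltaN N (fun z => MvPolynomial.eval z f)) /
        bargmannInner N (fun z => MvPolynomial.eval z f) (fun z => MvPolynomial.eval z f) := by
    intro f v hf h
    have hpos := ybN_pos f hf
    have hne : (ybN f : ℂ) ≠ 0 := by exact_mod_cast hpos.ne'
    have hI : bargmannInner N (fun z => MvPolynomial.eval z f) (fun z => MvPolynomial.eval z f)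
        = (ybN f : ℂ) := ybI_self f
    rw [yb_DeltaN, h, hI, eq_div_iff hne]
    push_cast; ring
  -- every admissible value in terms of the pair sums
  have val : ∀ (f : MvPolynomial (Fin N) ℂ) (r : ℝ), f ≠ 0 →
      (r : ℂ) = bargmannInner N (fun z => MvPolynomial.eval z f)
          (DeltaN N (fun z => MvPolynomial.eval z f)) /
        bargmannInner N (fun z => MvPolynomial.eval z f) (fun z => MvPolynomial.eval z f) →
      r * ybN f = (2 * π) ^ (-(3:ℝ) / 2) * (∑ p ∈ ybPairs N, ybI f (ybD p.1 p.2 f)).re := by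
    intro f r hf h
    have hpos := ybN_pos f hf
    have hne : (ybN f : ℂ) ≠ 0 := by exact_mod_cast hpos.ne'
    have hI : bargmannInner N (fun z => MvPolynomial.eval z f) (fun z => MvPolynomial.eval z f)
        = (ybN f : ℂ) := ybI_self f
    rw [yb_DeltaN, hI, eq_div_iff hne] at h
    have h2 := congrArg Complex.re h
    rw [← Complex.ofReal_mul, Complex.ofReal_re, Complex.re_ofReal_mul] at h2
    exact h2
  constructor
  · intro h01
    have hL1 : L ≤ 1 := by omega
    refine IsLeast.csInf_eq ⟨?_, ?_⟩
    · let f : MvPolynomial (Fin N) ℂ := (∑ k, MvPolynomial.X k) ^ L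
      have hne : f ≠ 0 := by
        intro h0
        have h := congrArg (MvPolynomial.eval (fun _ => (1 : ℂ))) h0
        simp only [f, map_pow, map_sum, MvPolynomial.eval_X, map_zero, Finset.sum_const,
          Finset.card_univ, Fintype.card_fin, nsmul_eq_mul, mul_one] at h
        have hN0 : (N : ℂ) ≠ 0 := Nat.cast_ne_zero.mpr (by omega)
        exact pow_ne_zero _ hN0 h
      have hsym : f.IsSymmetric := by
        intro e
        simp only [f, map_pow, map_sum, MvPolynomial.rename_X]
        rw [Equiv.sum_comp e (fun l => (MvPolynomial.X l : MvPolynomial (Fin N) ℂ))]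
      have hhom : f.IsHomogeneous L := by
        have := (MvPolynomial.IsHomogeneous.sum Finset.univ
          (fun k => (MvPolynomial.X k : MvPolynomial (Fin N) ℂ)) 1
          (fun k _ => MvPolynomial.isHomogeneous_X _ k)).pow L
        simpa using this
      exact ⟨f, hne, hsym, hhom, mem f _ hne (yb_small hL1 f hsym hhom)⟩
    · rintro r ⟨f, hf, hsym, hhom, hr⟩
      have h1 := val f r hf hr
      rw [yb_small hL1 f hsym hhom, ← Complex.ofReal_mul, Complex.ofReal_re, ← mul_assoc] at h1
      exact (mul_right_cancel₀ (ybN_pos f hf).ne' h1).ge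
  · intro h2
    refine IsLeast.csInf_eq ⟨?_, ?_⟩
    · have hne := ybF_ne_zero h2 hL
      exact ⟨ybF N L, hne, ybF_symm N L, ybF_hom N L,
        mem _ _ hne (yb_upper _ (ybF_symm N L) (ybF_hom N L) (ybF_transl (by omega))
          (fun i j hij => ybF_deg hij))⟩
    · rintro r ⟨f, hf, hsym, hhom, hr⟩
      have h1 := val f r hf hr
      have h3 := mul_le_mul_of_nonneg_left (yb_lower f hsym hhom) hK.le
      rw [← h1, ← mul_assoc] at h3
      exact le_of_mul_le_mul_right h3 (ybN_pos f hf)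
end
end
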